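/- For every prime p, the cyclic group ℤ/pℤ possesses the weak acyclic matching property: for all nonempty subsets A, B ⊆ ℤ/pℤ with |A| = |B| and A ∩ (A + B) = ∅, there exists an acyclic matching from A to B. -/

import Mathlib

open Finset Pointwise

/-- A matching from `A` to `B` is a bijection `f : A → B` with `a + f a ∉ A` for all `a ∈ A`. -/
def IsMatchingFrom {G : Type*} [AddCommGroup G] (A B : Finset G) (f : A ≃ B) : Prop :=
  ∀ a : A, (a : G) + (f a : G) ∉ A

/-- The multiplicity function of a bijection `f : A → B`:
`m_f x = |{a ∈ A : a + f a = x}|`. -/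
noncomputable def multiplicityFn {G : Type*} [AddCommGroup G] (A B : Finset G)
    (f : A ≃ B) : G → ℕ :=
  fun x => Nat.card {a : A // (a : G) + (f a : G) = x}

/-- A matching `f : A → B` is acyclic if every matching `g : A → B` with `m_g = m_f`
equals `f`. -/
def IsAcyclicMatchingFrom {G : Type*} [AddCommGroup G] (A B : Finset G) (f : A ≃ B) : Prop :=
  IsMatchingFrom A B f ∧
    ∀ g : A ≃ B, IsMatchingFrom A B g → multiplicityFn A B g = multiplicityFn A B f → g = f

/-- For finite sets with `#A ≤ #B` there is an injection `f : A → B` determined among all such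
injections by the number of times each value `a + f a` is attained. It is built greedily: pick a sum
`x = a + b`, pair off all `a ∈ A` with `x - a ∈ B`, and continue with what is left. -/
theorem exists_injOn_unique_of_card_filter_add_eq {G : Type*} [AddCommGroup G] [DecidableEq G]
    (A B : Finset G) (h : #A ≤ #B) :
    ∃ f : G → G, (∀ a ∈ A, f a ∈ B) ∧ Set.InjOn f A ∧
      ∀ g : G → G, (∀ a ∈ A, g a ∈ B) → Set.InjOn g A →
        (∀ x, #{a ∈ A | a + g a = x} = #{a ∈ A | a + f a = x}) → ∀ a ∈ A, g a = f a := by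
  induction hn : #A using Nat.strong_induction_on generalizing A B with
  | _ n ih =>
  rcases A.eq_empty_or_nonempty with rfl | ⟨a₀, ha₀⟩
  · exact ⟨id, by simp⟩
  obtain ⟨b₀, hb₀⟩ : B.Nonempty := by
    rw [← Finset.card_pos]
    exact (Finset.card_pos.2 ⟨a₀, ha₀⟩).trans_le h
  obtain ⟨x, hx⟩ : ∃ x, x = a₀ + b₀ := ⟨_, rfl⟩
  have hAB : #{a ∈ A | x - a ∈ B} = #{b ∈ B | x - b ∈ A} :=
    Finset.card_bij' (fun a _ => x - a) (fun b _ => x - b) (by simp +contextual)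
      (by simp +contextual) (by simp) (by simp)
  have hA := Finset.card_filter_add_card_filter_not (s := A) (fun a => x - a ∈ B)
  have hB := Finset.card_filter_add_card_filter_not (s := B) (fun b => x - b ∈ A)
  have hpos : 0 < #{a ∈ A | x - a ∈ B} :=
    Finset.card_pos.2 ⟨a₀, by simp [ha₀, hx, hb₀]⟩
  obtain ⟨f, hfB, hfi, hfu⟩ := ih #{a ∈ A | ¬ x - a ∈ B} (by omega)
    {a ∈ A | ¬ x - a ∈ B} {b ∈ B | ¬ x - b ∈ A} (by omega) rfl
  simp only [Finset.mem_filter, and_imp] at hfB hfu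
  refine ⟨fun a => if x - a ∈ B then x - a else f a, ?_, ?_, ?_⟩
  · intro a ha
    dsimp only
    split_ifs with hc
    · exact hc
    · exact (hfB a ha hc).1
  · intro a ha b hb hab
    simp only [Finset.mem_coe] at ha hb
    dsimp only at hab
    split_ifs at hab with h1 h2 h2
    · simpa using hab
    · exact absurd (by rw [← hab]; simpa using ha) (hfB b hb h2).2
    · exact absurd (by rw [hab]; simpa using hb) (hfB a ha h1).2
    · exact hfi (by simp [ha, h1]) (by simp [hb, h2]) hab
  · intro g hgB hgi hg
    have hsub : {a ∈ A | a + g a = x} ⊆ {a ∈ A | x - a ∈ B} := by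
      intro a
      simp only [Finset.mem_filter, and_imp]
      rintro ha rfl
      exact ⟨ha, by simpa using hgB a ha⟩
    have hle : #{a ∈ A | x - a ∈ B} ≤ #{a ∈ A | a + g a = x} := by
      rw [hg x]
      refine Finset.card_le_card fun a => ?_
      simp +contextual
    have heq := Finset.eq_of_subset_of_card_le hsub hle
    have hgx : ∀ a ∈ A, x - a ∈ B → g a = x - a := by
      intro a ha hc
      have : a ∈ ({a ∈ A | a + g a = x} : Finset G) := heq ▸ Finset.mem_filter.2 ⟨ha, hc⟩
      exact eq_sub_of_add_eq' (Finset.mem_filter.1 this).2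
    have key := hfu g ?_ (hgi.mono (by simp +contextual [Set.subset_def])) ?_
    · intro a ha
      dsimp only
      split_ifs with hc
      · exact hgx a ha hc
      · exact key a ha hc
    · intro a ha hc
      refine ⟨hgB a ha, fun hd => hc ?_⟩
      have h1 := hgx (x - g a) hd (by simpa using hgB a ha)
      have h2 : x - g a = a := hgi hd ha (by simpa using h1)
      rw [← h2]
      simpa using hgB a ha
    · intro y
      have split (k : G → G) : #{a ∈ A | a + k a = y} =
          #{a ∈ {a ∈ A | x - a ∈ B} | a + k a = y} +
            #{a ∈ {a ∈ A | ¬ x - a ∈ B} | a + k a = y} := by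
        rw [← Finset.card_filter_add_card_filter_not (s := {a ∈ A | a + k a = y})
          (fun a => x - a ∈ B)]
        simp only [Finset.filter_filter, and_comm]
      have hy := hg y
      rw [split, split] at hy
      have e1 : ({a ∈ {a ∈ A | x - a ∈ B} | a + g a = y} : Finset G) =
          {a ∈ {a ∈ A | x - a ∈ B} | a + (if x - a ∈ B then x - a else f a) = y} := by
        refine Finset.filter_congr fun a ha => ?_
        rw [Finset.mem_filter] at ha
        rw [if_pos ha.2, hgx a ha.1 ha.2]
      have e2 : ({a ∈ {a ∈ A | ¬ x - a ∈ B} | a + f a = y} : Finset G) =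
          {a ∈ {a ∈ A | ¬ x - a ∈ B} | a + (if x - a ∈ B then x - a else f a) = y} := by
        refine Finset.filter_congr fun a ha => ?_
        rw [if_neg (Finset.mem_filter.1 ha).2]
      rw [e1] at hy
      rw [e2]
      exact Nat.add_left_cancel hy

/-- The multiplicity function of an equivalence that is the restriction of `k : G → G` counts
elements of `A`. -/
theorem multiplicityFn_eq_card_filter {G : Type*} [AddCommGroup G] [DecidableEq G]
    {A B : Finset G} (f : A ≃ B) (k : G → G) (hk : ∀ a : A, (f a : G) = k a) (x : G) :
    multiplicityFn A B f x = #{a ∈ A | a + k a = x} := by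
  simp only [multiplicityFn, hk]
  rw [← Nat.card_eq_finsetCard]
  exact Nat.card_congr
    { toFun := fun a => ⟨a.1, Finset.mem_filter.2 ⟨a.1.2, a.2⟩⟩
      invFun := fun a => ⟨⟨a.1, (Finset.mem_filter.1 a.2).1⟩, (Finset.mem_filter.1 a.2).2⟩
      left_inv := fun _ => rfl
      right_inv := fun _ => rfl }

/-- For every prime `p`, the cyclic group `ℤ/pℤ` possesses the weak acyclic
matching property. -/
theorem zmod_prime_weak_acyclic_matching_property (p : ℕ) (hp : p.Prime)
    (A B : Finset (ZMod p)) (hA : A.Nonempty) (hB : B.Nonempty)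
    (hcard : A.card = B.card) (hdisj : A ∩ (A + B) = ∅) :
    ∃ f : A ≃ B, IsAcyclicMatchingFrom A B f := by
  obtain ⟨k, hkB, hki, hku⟩ := exists_injOn_unique_of_card_filter_add_eq A B hcard.le
  have hmatch (g : A ≃ B) : IsMatchingFrom A B g := fun a ha => by
    have : (a : ZMod p) + g a ∈ A ∩ (A + B) :=
      Finset.mem_inter.2 ⟨ha, Finset.add_mem_add a.2 (g a).2⟩
    simp [hdisj] at this
  let k' : A → B := fun a => ⟨k a, hkB a a.2⟩
  have hk' : Function.Bijective k' := by
    rw [Fintype.bijective_iff_injective_and_card]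
    refine ⟨fun a b hab => Subtype.ext (hki a.2 b.2 (congrArg Subtype.val hab)), ?_⟩
    simpa using hcard
  refine ⟨Equiv.ofBijective k' hk', hmatch _, fun g _ hg => ?_⟩
  let l : ZMod p → ZMod p := fun a => if h : a ∈ A then g ⟨a, h⟩ else 0
  have hl (a : A) : (g a : ZMod p) = l a := by simp [l]
  have hu := hku l (fun a ha => hl ⟨a, ha⟩ ▸ (g ⟨a, ha⟩).2)
    (fun a ha b hb hab => by
      have : g ⟨a, ha⟩ = g ⟨b, hb⟩ := Subtype.ext (by rw [hl, hl]; exact hab)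
      simpa using this)
    (fun x => by
      rw [← multiplicityFn_eq_card_filter g l hl, hg]
      exact multiplicityFn_eq_card_filter _ k (fun _ => rfl) x)
  ext a
  rw [hl, hu a a.2]
  rfl
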